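/- Every 2-dimensional weak pseudomanifold on at most 6 vertices is isomorphic to one of: the standard 2-sphere S²₄; the join S¹₃ * S⁰₂; the octahedron S⁰₂ * S⁰₂ * S⁰₂; the 6-vertex triangulation RP²₆ of the real projective plane; or Σ₁, the 6-vertex triangulation of the 2-sphere having a vertex of degree 3 and a vertex of degree 5. -/

import Mathlib

/- Formalization of definitions from:
   B. Bagchi, B. Datta, "Combinatorial triangulations of homology spheres". -/

open Finset

noncomputable section

attribute [local instance] Classical.propDecidable

namespace HomologySpheres

variable {V : Type*} [DecidableEq V] {W : Type*} [DecidableEq W]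

/-- The vertex set of a finite family of finite sets. -/
def verts (K : Finset (Finset V)) : Finset V := K.sup id

/-- An (abstract, finite) simplicial complex: a nonempty collection of nonempty
finite sets closed under taking nonempty subsets. -/
def IsComplex (K : Finset (Finset V)) : Prop :=
  K.Nonempty ∧ ∅ ∉ K ∧ ∀ s ∈ K, ∀ t : Finset V, t ⊆ s → t.Nonempty → t ∈ K

/-- The facets (maximal faces) of `K`. -/
def facets (K : Finset (Finset V)) : Finset (Finset V) :=
  K.filter fun s => ∀ t ∈ K, s ⊆ t → t = s

/-- `K` is pure of dimension `d`: every maximal face has `d + 1` vertices. -/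
def IsPure (d : ℕ) (K : Finset (Finset V)) : Prop :=
  ∀ s ∈ facets K, s.card = d + 1

/-- The link of a face `σ` in `K`. -/
def link (K : Finset (Finset V)) (σ : Finset V) : Finset (Finset V) :=
  K.filter fun τ => Disjoint τ σ ∧ τ ∪ σ ∈ K

/-- `L` is an induced (full) subcomplex of `K`. -/
def IsInduced (K L : Finset (Finset V)) : Prop :=
  L ⊆ K ∧ ∀ s ∈ K, s ⊆ verts L → s ∈ L

/-- The simplicial complement `C(L, K)`: the induced subcomplex of `K` on
`V(K) \ V(L)`. -/
def simpComplement (L K : Finset (Finset V)) : Finset (Finset V) :=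
  K.filter fun s => s ⊆ verts K \ verts L

/-- The simplicial neighbourhood `N(L, K)`: the subcomplex of `K` whose maximal
faces are the maximal faces of `K` meeting `V(L)`. -/
def simpNbhd (L K : Finset (Finset V)) : Finset (Finset V) :=
  K.filter fun s => ∃ t ∈ facets K, s ⊆ t ∧ (t ∩ verts L).Nonempty

/-- `fvec K i` is the number of `i`-dimensional faces of `K`. -/
def fvec (K : Finset (Finset V)) (i : ℕ) : ℕ :=
  (K.filter fun s => s.card = i + 1).card

/-- The number of facets of cardinality `d + 1` containing a given `(d-1)`-face
(the degree of the face in a (weak) pseudomanifold of dimension `d`). -/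
def degOf (K : Finset (Finset V)) (d : ℕ) (s : Finset V) : ℕ :=
  (K.filter fun t => s ⊆ t ∧ t.card = d + 1).card

/-- Simplicial isomorphism (via a vertex bijection carrying faces to faces). -/
def Iso (K : Finset (Finset V)) (L : Finset (Finset W)) : Prop :=
  ∃ f : V → W, Set.InjOn f ↑(verts K) ∧ L = K.image (Finset.image f)

/-- The join of two simplicial complexes (on disjoint vertex sets). -/
def sjoin (K L : Finset (Finset V)) : Finset (Finset V) :=
  K ∪ L ∪ (K ×ˢ L).image fun p => p.1 ∪ p.2

/-- The standard ball on vertex set `A`: all nonempty subsets of `A`. -/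
def stdBall (A : Finset V) : Finset (Finset V) := A.powerset.erase ∅

/-- The standard sphere on vertex set `A`: all nonempty proper subsets of `A`. -/
def stdSphere (A : Finset V) : Finset (Finset V) := (A.powerset.erase ∅).erase A

/-- `τ` is a free face of `K`, with `σ` the unique face properly containing it. -/
def IsFreeFace (K : Finset (Finset V)) (τ σ : Finset V) : Prop :=
  τ ∈ K ∧ σ ∈ K ∧ τ ⊂ σ ∧ ∀ ρ ∈ K, τ ⊂ ρ → ρ = σ

/-- An elementary collapse removes a free face together with the unique face
properly containing it. -/
def ElemCollapse (K K' : Finset (Finset V)) : Prop :=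
  ∃ τ σ : Finset V, IsFreeFace K τ σ ∧ K' = (K.erase τ).erase σ

/-- `K` collapses to `L` by a sequence of elementary collapses. -/
def CollapsesTo (K L : Finset (Finset V)) : Prop :=
  Relation.ReflTransGen ElemCollapse K L

/-- `K` is collapsible: it collapses to a single vertex. -/
def Collapsible (K : Finset (Finset V)) : Prop :=
  ∃ v : V, CollapsesTo K {{v}}

/-! ### Simplicial homology with `ℤ/2` coefficients (augmented chain complex).
A chain of level `n` is a `ZMod 2`-valued function supported on the faces of
cardinality `n` (the empty set, of cardinality `0`, serves as the `(-1)`-simplex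
of the augmented complex).  Reduced homology in dimension `q` lives at level
`q + 1`. -/

/-- `c` is a chain of level `n` of `K` (over `ℤ/2`). -/
def z2chainOK (K : Finset (Finset V)) (n : ℕ) (c : Finset V → ZMod 2) : Prop :=
  ∀ s : Finset V, c s ≠ 0 → s.card = n ∧ (s ∈ K ∨ s = ∅)

/-- The mod-2 boundary operator. -/
def z2bdry (K : Finset (Finset V)) (c : Finset V → ZMod 2) : Finset V → ZMod 2 :=
  fun t => ∑ v ∈ verts K \ t, c (insert v t)

/-- `K` is `ℤ/2`-acyclic: all reduced homology with `ℤ/2` coefficients vanishes,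
i.e. in the augmented mod-2 chain complex every cycle is a boundary. -/
def Z2Acyclic (K : Finset (Finset V)) : Prop :=
  ∀ (n : ℕ) (c : Finset V → ZMod 2), z2chainOK K n c → z2bdry K c = 0 →
    ∃ c', z2chainOK K (n + 1) c' ∧ z2bdry K c' = c

/-- `K` has the reduced `ℤ/2`-homology of the `d`-sphere: reduced homology
vanishes in all dimensions except `d` (level `d + 1`), where it is `ℤ/2`
(there is a cycle `z` which is not a boundary, and modulo boundaries every
cycle is `0` or `z`). -/
def Z2HomologySphere (d : ℕ) (K : Finset (Finset V)) : Prop :=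
  (∀ (n : ℕ) (c : Finset V → ZMod 2), n ≠ d + 1 → z2chainOK K n c →
    z2bdry K c = 0 → ∃ c', z2chainOK K (n + 1) c' ∧ z2bdry K c' = c) ∧
  (∃ z : Finset V → ZMod 2, z2chainOK K (d + 1) z ∧ z2bdry K z = 0 ∧
    (∀ c', z2chainOK K (d + 2) c' → z2bdry K c' ≠ z) ∧
    (∀ z', z2chainOK K (d + 1) z' → z2bdry K z' = 0 →
      (∃ c', z2chainOK K (d + 2) c' ∧ z2bdry K c' = z') ∨
      (∃ c', z2chainOK K (d + 2) c' ∧ z2bdry K c' = z + z')))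

/-! ### Integral simplicial homology via ordered chains (Munkres §13: ordered
simplicial homology, allowing repeated vertices, agrees with simplicial
homology). An ordered `m`-tuple chain corresponds to dimension `m - 1`; the
unique `0`-tuple is the `(-1)`-simplex of the augmented complex. -/

/-- `c` is an ordered chain of `K` over `ℤ`: supported on tuples whose image is
a face (the empty tuple being allowed in level `0`). -/
def zchainOK (K : Finset (Finset V)) {m : ℕ} (c : (Fin m → V) → ℤ) : Prop :=
  ∀ x : Fin m → V, c x ≠ 0 → (Finset.univ.image x ∈ K ∨ m = 0)

/-- The integral boundary operator on ordered chains. -/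
def zbdry (K : Finset (Finset V)) {m : ℕ} (c : (Fin (m + 1) → V) → ℤ) :
    (Fin m → V) → ℤ :=
  fun y => ∑ i : Fin (m + 1), (-1 : ℤ) ^ (i : ℕ) * ∑ v ∈ verts K, c (i.insertNth v y)

/-- `K` has the reduced integral homology of the `d`-sphere: reduced homology
vanishes in all dimensions except `d`, where it is infinite cyclic (there is a
cycle `z` such that every cycle is, modulo boundaries, a unique multiple of `z`). -/
def ZHomologySphere (d : ℕ) (K : Finset (Finset V)) : Prop :=
  (∀ c : (Fin 0 → V) → ℤ, ∃ c' : (Fin 1 → V) → ℤ, zchainOK K c' ∧ zbdry K c' = c) ∧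
  (∀ (m : ℕ) (c : (Fin (m + 1) → V) → ℤ), m ≠ d → zchainOK K c → zbdry K c = 0 →
    ∃ c' : (Fin (m + 2) → V) → ℤ, zchainOK K c' ∧ zbdry K c' = c) ∧
  (∃ z : (Fin (d + 1) → V) → ℤ, zchainOK K z ∧ zbdry K z = 0 ∧
    ∀ z' : (Fin (d + 1) → V) → ℤ, zchainOK K z' → zbdry K z' = 0 →
      ∃! k : ℤ, ∃ c'' : (Fin (d + 2) → V) → ℤ,
        zchainOK K c'' ∧ zbdry K c'' = z' - k • z)

/-- A weak pseudomanifold of dimension `d`: pure, and every `(d-1)`-face is in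
exactly two facets. -/
def IsWeakPseudomanifold (d : ℕ) (K : Finset (Finset V)) : Prop :=
  IsComplex K ∧ IsPure d K ∧ ∀ s ∈ K, s.card = d → degOf K d s = 2

/-- Adjacency of facets along a common `(d-1)`-face. -/
def FacetAdj (d : ℕ) (K : Finset (Finset V)) (s t : Finset V) : Prop :=
  s ∈ K ∧ t ∈ K ∧ s.card = d + 1 ∧ t.card = d + 1 ∧ (s ∩ t).card = d

/-- A pseudomanifold: a weak pseudomanifold in which any two facets are joined
by a chain of facets, consecutive ones sharing a `(d-1)`-face. -/
def IsPseudomanifold (d : ℕ) (K : Finset (Finset V)) : Prop :=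
  IsWeakPseudomanifold d K ∧ ∀ s ∈ K, ∀ t ∈ K, s.card = d + 1 → t.card = d + 1 →
    Relation.ReflTransGen (FacetAdj d K) s t

/-- A weak pseudomanifold with boundary. -/
def IsWeakPseudomanifoldWithBdry (d : ℕ) (K : Finset (Finset V)) : Prop :=
  IsComplex K ∧ IsPure d K ∧
  (∀ s ∈ K, s.card = d → degOf K d s = 1 ∨ degOf K d s = 2) ∧
  (∃ s ∈ K, s.card = d ∧ degOf K d s = 1)

/-- The boundary complex: all faces of degree-one `(d-1)`-faces. -/
def bdryComplex (d : ℕ) (K : Finset (Finset V)) : Finset (Finset V) :=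
  K.filter fun t => ∃ s ∈ K, t ⊆ s ∧ s.card = d ∧ degOf K d s = 1

/-- `K` is connected (any two vertices joined by a path of edges). -/
def SConnected (K : Finset (Finset V)) : Prop :=
  ∀ u ∈ verts K, ∀ v ∈ verts K,
    Relation.ReflTransGen (fun a b : V => ({a, b} : Finset V) ∈ K) u v

/-! ### Geometric realizations, subdivisions and combinatorial equivalence. -/

/-- A geometric simplicial complex in `ℝ^ℕ`: finitely many geometric simplices
(affinely independent vertex sets), closed under faces, any two of which meet
in a common face. -/
structure GComplex where
  faces : Finset (Finset (ℕ → ℝ))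
  nonempty : faces.Nonempty
  empty_not_mem : ∅ ∉ faces
  down_closed : ∀ s ∈ faces, ∀ t : Finset (ℕ → ℝ), t ⊆ s → t.Nonempty → t ∈ faces
  indep : ∀ s ∈ faces,
    AffineIndependent ℝ (fun x : {y : ℕ → ℝ // y ∈ s} => (x : ℕ → ℝ))
  glue : ∀ s ∈ faces, ∀ t ∈ faces,
    convexHull ℝ (s : Set (ℕ → ℝ)) ∩ convexHull ℝ (t : Set (ℕ → ℝ)) =
      convexHull ℝ ((s ∩ t : Finset (ℕ → ℝ)) : Set (ℕ → ℝ))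

/-- The geometric carrier (underlying polyhedron) of a geometric complex. -/
def GComplex.carrier (G : GComplex) : Set (ℕ → ℝ) :=
  ⋃ s ∈ G.faces, convexHull ℝ (s : Set (ℕ → ℝ))

/-- `G` realizes the abstract complex `K` via the vertex map `f`. -/
def RealizesMap (G : GComplex) (K : Finset (Finset V)) (f : V → ℕ → ℝ) : Prop :=
  Set.InjOn f ↑(verts K) ∧ G.faces = K.image (Finset.image f)

/-- `G` is a geometric realization of the abstract complex `K`. -/
def Realizes (G : GComplex) (K : Finset (Finset V)) : Prop :=
  ∃ f : V → ℕ → ℝ, RealizesMap G K f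

/-- `G'` is a subdivision of `G`: same carrier, and every simplex of `G'` is
contained in a simplex of `G`. -/
def Subdivides (G' G : GComplex) : Prop :=
  G'.carrier = G.carrier ∧
  ∀ s ∈ G'.faces, ∃ t ∈ G.faces,
    convexHull ℝ (s : Set (ℕ → ℝ)) ⊆ convexHull ℝ (t : Set (ℕ → ℝ))

/-- Combinatorial equivalence: `K` and `L` admit isomorphic subdivisions. -/
def CombEquiv (K : Finset (Finset V)) (L : Finset (Finset W)) : Prop :=
  ∃ G1 G1' G2 G2' : GComplex, Realizes G1 K ∧ Realizes G2 L ∧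
    Subdivides G1' G1 ∧ Subdivides G2' G2 ∧ Iso G1'.faces G2'.faces

/-- A combinatorial `d`-ball: combinatorially equivalent to the standard ball. -/
def IsCombBall (d : ℕ) (K : Finset (Finset V)) : Prop :=
  ∃ A : Finset ℕ, A.card = d + 1 ∧ CombEquiv K (stdBall A)

/-- A combinatorial `d`-sphere: combinatorially equivalent to the standard sphere. -/
def IsCombSphere (d : ℕ) (K : Finset (Finset V)) : Prop :=
  ∃ A : Finset ℕ, A.card = d + 2 ∧ CombEquiv K (stdSphere A)

/-- A combinatorial `d`-manifold: every vertex link is a combinatorial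
`(d-1)`-sphere. -/
def IsCombManifold (d : ℕ) (K : Finset (Finset V)) : Prop :=
  IsComplex K ∧ ∀ v ∈ verts K, IsCombSphere (d - 1) (link K {v})

/-- A combinatorial `d`-manifold with boundary. -/
def IsCombManifoldWithBdry (d : ℕ) (K : Finset (Finset V)) : Prop :=
  IsComplex K ∧
  (∀ v ∈ verts K, IsCombSphere (d - 1) (link K {v}) ∨
    IsCombBall (d - 1) (link K {v})) ∧
  (∃ v ∈ verts K, IsCombBall (d - 1) (link K {v}))

/-- A pl `k`-ball: a polyhedron carried by some geometric complex whose face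
structure is a combinatorial `k`-ball. -/
def IsPLBall (k : ℕ) (P : Set (ℕ → ℝ)) : Prop :=
  ∃ G : GComplex, G.carrier = P ∧ IsCombBall k G.faces

/-- Elementary polyhedral collapse: `P = P' ∪ B` with `B` a pl `k`-ball and
`P' ∩ B` a pl `(k-1)`-ball. -/
def PolyElemCollapse (P P' : Set (ℕ → ℝ)) : Prop :=
  ∃ k : ℕ, 1 ≤ k ∧ ∃ B : Set (ℕ → ℝ),
    IsPLBall k B ∧ P = P' ∪ B ∧ IsPLBall (k - 1) (P' ∩ B)

/-- Polyhedral collapse. -/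
def PolyCollapsesTo (P Q : Set (ℕ → ℝ)) : Prop :=
  Relation.ReflTransGen PolyElemCollapse P Q

/-- Carrier of a subcomplex under a vertex realization map `f`. -/
def subCarrier (f : V → ℕ → ℝ) (L : Finset (Finset V)) : Set (ℕ → ℝ) :=
  ⋃ s ∈ L, convexHull ℝ ((s.image f : Finset (ℕ → ℝ)) : Set (ℕ → ℝ))

/-! ### Bistellar moves. -/

/-- The core `β = {x ∈ A : A \ {x} ∈ X}` of a `(d+2)`-set `A`. -/
def bcore (X : Finset (Finset V)) (A : Finset V) : Finset V :=
  A.filter fun x => A.erase x ∈ X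

/-- `κ_A` is a bistellar `i`-move on the `d`-dimensional complex `X`:
`A` has `d + 2` elements and contains at least one and at most `d + 1` facets
of `X`; with `β` the core of `A` and `α = A \ β` an `i`-face of `X`, one has
`β ∉ X`, and either `α` is a facet of `X` or `Lk_X(α)` has vertex set `β`. -/
def BistellarIMove (d i : ℕ) (X : Finset (Finset V)) (A : Finset V) : Prop :=
  A.card = d + 2 ∧
  0 < ((facets X).filter fun σ => σ ⊆ A).card ∧
  ((facets X).filter fun σ => σ ⊆ A).card ≤ d + 1 ∧
  bcore X A ∉ X ∧
  A \ bcore X A ∈ X ∧ (A \ bcore X A).card = i + 1 ∧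
  (A \ bcore X A ∈ facets X ∨ verts (link X (A \ bcore X A)) = bcore X A)

/-! ### The explicit small complexes of the paper. -/

/-- The complex generated by a list of facets: all nonempty subsets thereof. -/
def genBy (F : Finset (Finset ℕ)) : Finset (Finset ℕ) :=
  F.sup fun s => s.powerset.erase ∅

/-- The standard 2-sphere `S²₄`. -/
def S24 : Finset (Finset ℕ) := stdSphere {1, 2, 3, 4}

/-- The join `S¹₃ * S⁰₂`. -/
def S13S02 : Finset (Finset ℕ) := sjoin (stdSphere {1, 2, 3}) (stdSphere {4, 5})

/-- The octahedron `S⁰₂ * S⁰₂ * S⁰₂`. -/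
def Octa : Finset (Finset ℕ) :=
  sjoin (stdSphere {1, 2}) (sjoin (stdSphere {3, 4}) (stdSphere {5, 6}))

/-- The 6-vertex real projective plane `ℝP²₆`. -/
def RP26 : Finset (Finset ℕ) :=
  genBy {{1, 2, 3}, {1, 2, 4}, {1, 3, 5}, {1, 4, 6}, {1, 5, 6},
         {2, 3, 6}, {2, 4, 5}, {2, 5, 6}, {3, 4, 5}, {3, 4, 6}}

/-- `Σ₁`: the 6-vertex 2-sphere with a vertex of degree 3 and one of degree 5. -/
def Sigma1 : Finset (Finset ℕ) :=
  genBy {{1, 2, 5}, {1, 2, 6}, {1, 5, 6}, {2, 3, 5},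
         {2, 3, 6}, {3, 4, 5}, {3, 4, 6}, {4, 5, 6}}

/-- The double pyramid `S¹₅ * S⁰₂`. -/
def S15S02 : Finset (Finset ℕ) :=
  sjoin (genBy {{1, 2}, {2, 3}, {3, 4}, {4, 5}, {1, 5}}) (stdSphere {6, 7})

/-- `Σ₂` (7-vertex 2-sphere with 10 triangles). -/
def Sigma2 : Finset (Finset ℕ) :=
  genBy {{1, 2, 6}, {1, 2, 7}, {1, 6, 7}, {2, 3, 6}, {2, 3, 7},
         {3, 4, 6}, {3, 4, 7}, {4, 5, 6}, {4, 5, 7}, {5, 6, 7}}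

/-- `Σ₃` (7-vertex 2-sphere with 10 triangles). -/
def Sigma3 : Finset (Finset ℕ) :=
  genBy {{1, 2, 6}, {1, 2, 7}, {1, 6, 7}, {2, 3, 4}, {2, 3, 7},
         {2, 4, 6}, {3, 4, 7}, {4, 5, 6}, {4, 5, 7}, {5, 6, 7}}

/-- `Σ₄` (7-vertex 2-sphere with 10 triangles). -/
def Sigma4 : Finset (Finset ℕ) :=
  genBy {{1, 2, 4}, {1, 2, 7}, {1, 4, 5}, {1, 5, 6}, {1, 6, 7},
         {2, 3, 4}, {2, 3, 7}, {3, 4, 7}, {4, 5, 7}, {5, 6, 7}}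

/-- `Σ₅` (7-vertex 2-sphere with 10 triangles). -/
def Sigma5 : Finset (Finset ℕ) :=
  genBy {{1, 2, 3}, {1, 2, 6}, {1, 3, 5}, {1, 5, 6}, {2, 3, 4},
         {2, 4, 6}, {3, 4, 5}, {4, 5, 7}, {4, 6, 7}, {5, 6, 7}}

/-- `Υ₁ = S²₄ ∪ S²₄`: two tetrahedral spheres sharing exactly one vertex. -/
def Upsilon1 : Finset (Finset ℕ) :=
  stdSphere {1, 2, 3, 7} ∪ stdSphere {4, 5, 6, 7}

/-- `Υ₂ = S²₄ ∪ (S⁰₂ * S¹₃)`: a tetrahedral sphere and a join, where the two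
common vertices span an edge of the `S²₄`. -/
def Upsilon2 : Finset (Finset ℕ) :=
  stdSphere {4, 5, 6, 7} ∪ sjoin (stdSphere {6, 7}) (stdSphere {1, 2, 3})

/-- The complex `R` obtained from `ℝP²₆` by the generalized bistellar 1-move
`κ_A`, `A = {1, 2, 5, 6}` (all such choices of `A` yield isomorphic complexes). -/
def Rcomplex : Finset (Finset ℕ) :=
  genBy {{1, 2, 3}, {1, 2, 4}, {1, 2, 5}, {1, 2, 6}, {1, 3, 5},
         {1, 4, 6}, {2, 3, 6}, {2, 4, 5}, {3, 4, 5}, {3, 4, 6}}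



/-! ### Auxiliary material for the proof -/

/-- The properties of a 2-dimensional weak pseudomanifold that are used. -/
structure Good {V : Type*} [DecidableEq V] (K : Finset (Finset V)) : Prop where
  hne : ∅ ∉ K
  down : ∀ s ∈ K, ∀ t : Finset V, t ⊆ s → t.Nonempty → t ∈ K
  tri : ∀ s ∈ K, ∃ t ∈ K, s ⊆ t ∧ t.card = 3
  deg : ∀ s ∈ K, s.card = 2 → degOf K 2 s = 2

lemma good_of_wpm {V : Type*} [DecidableEq V] {K : Finset (Finset V)}
    (hw : IsWeakPseudomanifold 2 K) : Good K := by
  obtain ⟨⟨_, h2, h3⟩, hp, hd⟩ := hw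
  refine ⟨h2, h3, ?_, hd⟩
  intro s hs
  obtain ⟨t, hst, ht⟩ := K.exists_le_maximal hs
  refine ⟨t, ht.prop, hst, hp t ?_⟩
  simp only [facets, Finset.mem_filter]
  exact ⟨ht.prop, fun u hu htu => (ht.eq_of_le hu htu).symm⟩

lemma subset_verts {V : Type*} [DecidableEq V] {K : Finset (Finset V)} {s : Finset V}
    (hs : s ∈ K) : s ⊆ verts K := Finset.le_sup (f := id) hs

lemma mem_verts {V : Type*} [DecidableEq V] {K : Finset (Finset V)} {v : V} :
    v ∈ verts K ↔ ∃ s ∈ K, v ∈ s := by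
  simp [verts, Finset.mem_sup]

lemma iso_trans {V W X : Type*} [DecidableEq V] [DecidableEq W] [DecidableEq X]
    {K : Finset (Finset V)} {L : Finset (Finset W)} {M : Finset (Finset X)}
    (h1 : Iso K L) (h2 : Iso L M) : Iso K M := by
  obtain ⟨f, hf, rfl⟩ := h1
  obtain ⟨g, hg, rfl⟩ := h2
  refine ⟨g ∘ f, ?_, ?_⟩
  · have key : ∀ x ∈ verts K, f x ∈ verts (K.image (Finset.image f)) := by
      intro x hx
      obtain ⟨s, hs, hxs⟩ := mem_verts.1 hx
      exact mem_verts.2 ⟨s.image f, Finset.mem_image_of_mem _ hs, Finset.mem_image_of_mem _ hxs⟩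
    intro x hx y hy hxy
    exact hf hx hy (hg (key x hx) (key y hy) hxy)
  · rw [Finset.image_image]
    congr 1
    funext s
    simp [Finset.image_image]

lemma good_image {V W : Type*} [DecidableEq V] [DecidableEq W] {K : Finset (Finset V)}
    (hK : Good K) (f : V → W) (hf : Set.InjOn f ↑(verts K)) :
    Good (K.image (Finset.image f)) := by
  have hsub : ∀ s ∈ K, (s : Set V) ⊆ ↑(verts K) := fun s hs =>
    Finset.coe_subset.2 (subset_verts hs)
  have hcard : ∀ s ∈ K, (s.image f).card = s.card := fun s hs =>
    Finset.card_image_of_injOn (hf.mono (hsub s hs))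
  have himg : ∀ s ∈ K, ∀ t ∈ K, s.image f ⊆ t.image f → s ⊆ t := by
    intro s hs t ht h x hx
    obtain ⟨y, hy, hxy⟩ := Finset.mem_image.1 (h (Finset.mem_image_of_mem f hx))
    have := hf (hsub t ht hy) (hsub s hs hx) hxy
    exact this ▸ hy
  constructor
  · intro h
    obtain ⟨s, hs, h⟩ := Finset.mem_image.1 h
    rw [Finset.image_eq_empty] at h
    exact hK.hne (h ▸ hs)
  · intro s hs t hts htn
    obtain ⟨s, hs', rfl⟩ := Finset.mem_image.1 hs
    obtain ⟨t', ht', rfl⟩ := Finset.subset_image_iff.1 hts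
    exact Finset.mem_image_of_mem _ (hK.down s hs' t' ht' (Finset.image_nonempty.1 htn))
  · intro s hs
    obtain ⟨s, hs', rfl⟩ := Finset.mem_image.1 hs
    obtain ⟨t, ht, hst, h3⟩ := hK.tri s hs'
    exact ⟨t.image f, Finset.mem_image_of_mem _ ht, Finset.image_subset_image hst,
      (hcard t ht).trans h3⟩
  · intro s hs0 h2
    obtain ⟨s, hs, rfl⟩ := Finset.mem_image.1 hs0
    rw [hcard s hs] at h2
    refine Eq.trans ?_ (hK.deg s hs h2)
    unfold degOf
    symm
    refine Finset.card_bij (fun t _ => t.image f) ?_ ?_ ?_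
    · intro t ht
      simp only [Finset.mem_filter] at ht ⊢
      exact ⟨Finset.mem_image_of_mem _ ht.1, Finset.image_subset_image ht.2.1,
        (hcard t ht.1).trans ht.2.2⟩
    · intro t ht u hu htu
      simp only [Finset.mem_filter] at ht hu
      exact (himg t ht.1 u hu.1 htu.subset).antisymm (himg u hu.1 t ht.1 htu.symm.subset)
    · intro u hu
      simp only [Finset.mem_filter] at hu
      obtain ⟨hu1, hu2, hu3⟩ := hu
      obtain ⟨t, ht, rfl⟩ := Finset.mem_image.1 hu1
      refine ⟨t, ?_, rfl⟩
      simp only [Finset.mem_filter]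
      exact ⟨ht, himg s hs t ht hu2, (hcard t ht).symm.trans hu3⟩

/-- Among four booleans, none or exactly two are true. -/
def okk (w x y z : Bool) : Bool :=
  let n := w.toNat + x.toNat + y.toNat + z.toNat
  n == 0 || n == 2

lemma okk_xor {w x y z : Bool} (h : okk w x y z = true) : z = xor w (xor x y) := by
  revert w x y z; decide

lemma good_okk {K : Finset (Finset (Fin 6))} (hK : Good K) (p q r s t u : Fin 6)
    (hn : [p, q, r, s, t, u].Nodup) :
    okk (decide ({p, q, r} ∈ K)) (decide ({p, q, s} ∈ K)) (decide ({p, q, t} ∈ K))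
      (decide ({p, q, u} ∈ K)) = true := by
  have huniv : ∀ x : Fin 6, x = p ∨ x = q ∨ x = r ∨ x = s ∨ x = t ∨ x = u := by
    revert p q r s t u; decide +kernel
  simp only [List.nodup_cons, List.mem_cons, List.not_mem_nil, or_false, not_or] at hn
  obtain ⟨⟨hpq, hpr, hps, hpt, hpu⟩, ⟨hqr, hqs, hqt, hqu⟩, ⟨hrs, hrt, hru⟩, ⟨hst, hsu⟩, htu, -⟩ := hn
  have hv4 : ∀ v ∈ ({r, s, t, u} : Finset (Fin 6)), p ≠ v ∧ q ≠ v := by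
    intro v hv
    simp only [Finset.mem_insert, Finset.mem_singleton] at hv
    rcases hv with rfl | rfl | rfl | rfl
    exacts [⟨hpr, hqr⟩, ⟨hps, hqs⟩, ⟨hpt, hqt⟩, ⟨hpu, hqu⟩]
  by_cases hpK : ({p, q} : Finset (Fin 6)) ∈ K
  · have hd := hK.deg _ hpK (Finset.card_pair hpq)
    have hF : (K.filter fun x => {p, q} ⊆ x ∧ x.card = 2 + 1)
        = (({r, s, t, u} : Finset (Fin 6)).filter fun v => {p, q, v} ∈ K).image
            (fun v => ({p, q, v} : Finset (Fin 6))) := by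
      ext x
      simp only [Finset.mem_filter, Finset.mem_image]
      constructor
      · rintro ⟨hx, hsub, hc⟩
        have h1 : (x \ {p, q}).card = 1 := by
          rw [Finset.card_sdiff_of_subset hsub, Finset.card_pair hpq, hc]
        obtain ⟨v, hv⟩ := Finset.card_eq_one.1 h1
        have hx' : x = {p, q, v} := by
          rw [← Finset.union_sdiff_of_subset hsub, hv]
          ext y; simp
        have hvm : v ∈ x \ {p, q} := by rw [hv]; simp
        have hvn : ¬ (v = p ∨ v = q) := by simpa using (Finset.mem_sdiff.1 hvm).2
        refine ⟨v, ⟨?_, hx' ▸ hx⟩, hx'.symm⟩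
        simp only [Finset.mem_insert, Finset.mem_singleton]
        rcases huniv v with h | h | h
        · exact absurd (Or.inl h) hvn
        · exact absurd (Or.inr h) hvn
        · exact h
      · rintro ⟨v, ⟨hv, hvK⟩, rfl⟩
        refine ⟨hvK, ?_, ?_⟩
        · intro y; simp; tauto
        · obtain ⟨h1, h2⟩ := hv4 v hv
          exact Finset.card_eq_three.2 ⟨p, q, v, hpq, h1, h2, rfl⟩
    have hinj : Set.InjOn (fun v => ({p, q, v} : Finset (Fin 6)))
        ↑(({r, s, t, u} : Finset (Fin 6)).filter fun v => {p, q, v} ∈ K) := by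
      intro v hv w hw hvw
      obtain ⟨h1, h2⟩ := hv4 v (Finset.mem_filter.1 (Finset.mem_coe.1 hv)).1
      have hvw' : ({p, q, v} : Finset (Fin 6)) = {p, q, w} := hvw
      have hm : v ∈ ({p, q, w} : Finset (Fin 6)) := by
        have : v ∈ ({p, q, v} : Finset (Fin 6)) := by simp
        rwa [hvw'] at this
      simp only [Finset.mem_insert, Finset.mem_singleton] at hm
      exact (hm.resolve_left h1.symm).resolve_left h2.symm
    unfold degOf at hd
    have hd2 : (({r, s, t, u} : Finset (Fin 6)).filter fun v => {p, q, v} ∈ K).card = 2 := by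
      rw [← Finset.card_image_of_injOn hinj, ← hF]
      convert hd
    rw [Finset.card_filter, Finset.sum_insert, Finset.sum_insert, Finset.sum_insert,
      Finset.sum_singleton] at hd2
    · have : ∀ P : Prop, ∀ _ : Decidable P, (decide P).toNat = if P then 1 else 0 := by
        intro P _; by_cases h : P <;> simp [h]
      have e : (decide ({p, q, r} ∈ K)).toNat + (decide ({p, q, s} ∈ K)).toNat +
          (decide ({p, q, t} ∈ K)).toNat + (decide ({p, q, u} ∈ K)).toNat = 2 := by
        simp only [this]; omega
      simp only [okk, e]; decide
    · simpa using htu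
    · simpa using ⟨hst, hsu⟩
    · simpa using ⟨hrs, hrt, hru⟩
  · have : ∀ v, ({p, q, v} : Finset (Fin 6)) ∉ K := fun v hv =>
      hpK (hK.down _ hv _ (by intro y; simp; tauto) (by simp))
    simp [this, okk]

/-- Facets of the five models, on the vertex set `Fin 6`. -/
def mS : Finset (Finset (Fin 6)) := {{0, 1, 2}, {0, 1, 3}, {0, 2, 3}, {1, 2, 3}}
def mJ : Finset (Finset (Fin 6)) :=
  {{0, 1, 3}, {0, 1, 4}, {0, 2, 3}, {0, 2, 4}, {1, 2, 3}, {1, 2, 4}}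
def mO : Finset (Finset (Fin 6)) :=
  {{0, 2, 4}, {0, 2, 5}, {0, 3, 4}, {0, 3, 5}, {1, 2, 4}, {1, 2, 5}, {1, 3, 4}, {1, 3, 5}}
def mR : Finset (Finset (Fin 6)) :=
  {{0, 1, 2}, {0, 1, 3}, {0, 2, 4}, {0, 3, 5}, {0, 4, 5},
   {1, 2, 5}, {1, 3, 4}, {1, 4, 5}, {2, 3, 4}, {2, 3, 5}}
def mG : Finset (Finset (Fin 6)) :=
  {{0, 1, 4}, {0, 1, 5}, {0, 4, 5}, {1, 2, 4}, {1, 2, 5}, {2, 3, 4}, {2, 3, 5}, {3, 4, 5}}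

/-- The labelled solutions containing `012` and `013`, each given by a relabelling
onto one of the models. -/
def table : List ((Fin 6 → Fin 6) × Finset (Finset (Fin 6))) := [
  (![0, 1, 3, 4, 5, 2], mJ),
  (![1, 4, 0, 2, 3, 5], mG),
  (![1, 4, 2, 0, 3, 5], mG),
  (![0, 2, 4, 5, 1, 3], mO),
  (![1, 2, 4, 5, 3, 0], mG),
  (![0, 3, 1, 2, 5, 4], mJ),
  (![1, 0, 4, 5, 3, 2], mG),
  (![4, 1, 0, 2, 3, 5], mG),
  (![4, 5, 0, 3, 2, 1], mG),
  (![0, 1, 2, 3, 5, 4], mR),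
  (![4, 1, 2, 0, 5, 3], mG),
  (![4, 0, 1, 5, 3, 2], mG),
  (![4, 0, 5, 1, 2, 3], mG),
  (![4, 1, 2, 0, 3, 5], mG),
  (![0, 1, 2, 3, 4, 5], mR),
  (![4, 5, 0, 3, 1, 2], mG),
  (![4, 1, 0, 2, 5, 3], mG),
  (![4, 0, 5, 1, 3, 2], mG),
  (![4, 0, 1, 5, 2, 3], mG),
  (![0, 2, 4, 5, 3, 1], mO),
  (![1, 2, 4, 5, 0, 3], mG),
  (![1, 4, 2, 0, 5, 3], mG),
  (![1, 4, 0, 2, 5, 3], mG),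
  (![0, 1, 3, 4, 2, 5], mJ),
  (![1, 0, 4, 5, 2, 3], mG),
  (![0, 3, 1, 2, 4, 5], mJ),
  (![3, 0, 1, 2, 5, 4], mJ),
  (![0, 1, 4, 5, 3, 2], mG),
  (![0, 4, 1, 5, 3, 2], mG),
  (![0, 4, 5, 1, 2, 3], mG),
  (![0, 4, 5, 1, 3, 2], mG),
  (![0, 4, 1, 5, 2, 3], mG),
  (![0, 1, 4, 5, 2, 3], mG),
  (![3, 0, 1, 2, 4, 5], mJ),
  (![0, 1, 2, 3, 4, 5], mS)]

/-- The given triangle indicator agrees with the model `p.2` pulled back along `p.1`. -/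
def agrees (p : (Fin 6 → Fin 6) × Finset (Finset (Fin 6)))
    (l : List (Fin 6 × Fin 6 × Fin 6 × Bool)) : Bool :=
  l.all fun x => x.2.2.2 == decide ({p.1 x.1, p.1 x.2.1, p.1 x.2.2.1} ∈ p.2)

lemma search (b012 b013 b014 b015 b023 b024 b025 b034 b035 b045 b123 b124 b125 b134 b135 b145 b234 b235 b245 b345 : Bool)
    (h01 : okk b012 b013 b014 b015 = true)
    (h02 : okk b012 b023 b024 b025 = true)
    (h03 : okk b013 b023 b034 b035 = true)
    (h04 : okk b014 b024 b034 b045 = true)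
    (h05 : okk b015 b025 b035 b045 = true)
    (h12 : okk b012 b123 b124 b125 = true)
    (h13 : okk b013 b123 b134 b135 = true)
    (h14 : okk b014 b124 b134 b145 = true)
    (h15 : okk b015 b125 b135 b145 = true)
    (h23 : okk b023 b123 b234 b235 = true)
    (h24 : okk b024 b124 b234 b245 = true)
    (h25 : okk b025 b125 b235 b245 = true)
    (h34 : okk b034 b134 b234 b345 = true)
    (h35 : okk b035 b135 b235 b345 = true)
    (h45 : okk b045 b145 b245 b345 = true)
    (e1 : b012 = true) (e2 : b013 = true) :
    ∃ p ∈ table, agrees p [(0, 1, 2, b012), (0, 1, 3, b013), (0, 1, 4, b014), (0, 1, 5, b015), (0, 2, 3, b023), (0, 2,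
      4, b024), (0, 2, 5, b025), (0, 3, 4, b034), (0, 3, 5, b035), (0, 4, 5, b045), (1, 2,
      3, b123), (1, 2, 4, b124), (1, 2, 5, b125), (1, 3, 4, b134), (1, 3, 5, b135), (1, 4,
      5, b145), (2, 3, 4, b234), (2, 3, 5, b235), (2, 4, 5, b245), (3, 4, 5, b345)] = true := by
  obtain rfl := okk_xor h01
  obtain rfl := okk_xor h02
  obtain rfl := okk_xor h03
  obtain rfl := okk_xor h04
  obtain rfl := okk_xor h12
  obtain rfl := okk_xor h13
  obtain rfl := okk_xor h14
  obtain rfl := okk_xor h23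
  obtain rfl := okk_xor h24
  obtain rfl := okk_xor h34
  subst e1 e2
  revert b014 b023 b024 b034 b123 b124 b134 b234
  decide +kernel

lemma table_inj : ∀ p ∈ table, Function.Injective p.1 := by
  have h : table.all (fun p => decide (Function.Injective p.1)) = true := by decide +kernel
  intro p hp
  exact of_decide_eq_true (List.all_eq_true.1 h p hp)

lemma table_mem : ∀ p ∈ table, p.2 = mS ∨ p.2 = mJ ∨ p.2 = mO ∨ p.2 = mR ∨ p.2 = mG := by
  have h : table.all (fun p => decide (p.2 = mS ∨ p.2 = mJ ∨ p.2 = mO ∨ p.2 = mR ∨ p.2 = mG))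
      = true := by decide +kernel
  intro p hp
  exact of_decide_eq_true (List.all_eq_true.1 h p hp)

lemma table_card : ∀ p ∈ table, ∀ t ∈ p.2, t.card = 3 := by
  have h : ∀ M ∈ [mS, mJ, mO, mR, mG], ∀ t : Finset (Fin 6), t ∈ M → t.card = 3 := by
    simp only [List.forall_mem_cons]
    have hall : ∀ M : Finset (Finset (Fin 6)), M ⊆ univ.powersetCard 3 →
        ∀ t ∈ M, t.card = 3 := fun M hM t ht => (Finset.mem_powersetCard.1 (hM ht)).2
    refine ⟨hall _ ?_, hall _ ?_, hall _ ?_, hall _ ?_, hall _ ?_, by simp⟩ <;> decide +kernel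
  intro p hp
  refine h p.2 ?_
  simpa using table_mem p hp

lemma triples : ∀ s : Finset (Fin 6), s.card = 3 →
    ∃ x ∈ ([(0, 1, 2), (0, 1, 3), (0, 1, 4), (0, 1, 5), (0, 2, 3), (0, 2, 4), (0, 2, 5), (0, 3, 4), (0,
      3, 5), (0, 4, 5), (1, 2, 3), (1, 2, 4), (1, 2, 5), (1, 3, 4), (1, 3, 5), (1, 4, 5),
      (2, 3, 4), (2, 3, 5), (2, 4, 5), (3, 4, 5)] : List (Fin 6 × Fin 6 × Fin 6)), s = {x.1, x.2.1, x.2.2} := by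
  decide +kernel

/-- The complex generated by `M`. -/
def gen6 (M : Finset (Finset (Fin 6))) : Finset (Finset (Fin 6)) :=
  univ.filter fun s => s.Nonempty ∧ ∃ t ∈ M, s ⊆ t

lemma core {K : Finset (Finset (Fin 6))} (hK : Good K) (h012 : {0, 1, 2} ∈ K)
    (h013 : {0, 1, 3} ∈ K) : ∃ p ∈ table, Iso K (gen6 p.2) := by
  obtain ⟨b, hb⟩ : ∃ b : Fin 6 → Fin 6 → Fin 6 → Bool,
    ∀ i j k, b i j k = decide ({i, j, k} ∈ K) := ⟨_, fun _ _ _ => rfl⟩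
  have sw1 : ∀ i j k, b i j k = b j i k := by
    intro i j k; rw [hb, hb, Finset.insert_comm]
  have sw2 : ∀ i j k, b i j k = b i k j := by
    intro i j k; rw [hb, hb, Finset.pair_comm]
  have hd := good_okk hK
  simp only [← hb] at hd
  have h01 : okk (b 0 1 2) (b 0 1 3) (b 0 1 4) (b 0 1 5) = true := by
    simpa only [sw1, sw2] using hd 0 1 2 3 4 5 (by decide)
  have h02 : okk (b 0 1 2) (b 0 2 3) (b 0 2 4) (b 0 2 5) = true := by
    simpa only [sw1, sw2] using hd 0 2 1 3 4 5 (by decide)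
  have h03 : okk (b 0 1 3) (b 0 2 3) (b 0 3 4) (b 0 3 5) = true := by
    simpa only [sw1, sw2] using hd 0 3 1 2 4 5 (by decide)
  have h04 : okk (b 0 1 4) (b 0 2 4) (b 0 3 4) (b 0 4 5) = true := by
    simpa only [sw1, sw2] using hd 0 4 1 2 3 5 (by decide)
  have h05 : okk (b 0 1 5) (b 0 2 5) (b 0 3 5) (b 0 4 5) = true := by
    simpa only [sw1, sw2] using hd 0 5 1 2 3 4 (by decide)
  have h12 : okk (b 0 1 2) (b 1 2 3) (b 1 2 4) (b 1 2 5) = true := by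
    simpa only [sw1, sw2] using hd 1 2 0 3 4 5 (by decide)
  have h13 : okk (b 0 1 3) (b 1 2 3) (b 1 3 4) (b 1 3 5) = true := by
    simpa only [sw1, sw2] using hd 1 3 0 2 4 5 (by decide)
  have h14 : okk (b 0 1 4) (b 1 2 4) (b 1 3 4) (b 1 4 5) = true := by
    simpa only [sw1, sw2] using hd 1 4 0 2 3 5 (by decide)
  have h15 : okk (b 0 1 5) (b 1 2 5) (b 1 3 5) (b 1 4 5) = true := by
    simpa only [sw1, sw2] using hd 1 5 0 2 3 4 (by decide)
  have h23 : okk (b 0 2 3) (b 1 2 3) (b 2 3 4) (b 2 3 5) = true := by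
    simpa only [sw1, sw2] using hd 2 3 0 1 4 5 (by decide)
  have h24 : okk (b 0 2 4) (b 1 2 4) (b 2 3 4) (b 2 4 5) = true := by
    simpa only [sw1, sw2] using hd 2 4 0 1 3 5 (by decide)
  have h25 : okk (b 0 2 5) (b 1 2 5) (b 2 3 5) (b 2 4 5) = true := by
    simpa only [sw1, sw2] using hd 2 5 0 1 3 4 (by decide)
  have h34 : okk (b 0 3 4) (b 1 3 4) (b 2 3 4) (b 3 4 5) = true := by
    simpa only [sw1, sw2] using hd 3 4 0 1 2 5 (by decide)
  have h35 : okk (b 0 3 5) (b 1 3 5) (b 2 3 5) (b 3 4 5) = true := by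
    simpa only [sw1, sw2] using hd 3 5 0 1 2 4 (by decide)
  have h45 : okk (b 0 4 5) (b 1 4 5) (b 2 4 5) (b 3 4 5) = true := by
    simpa only [sw1, sw2] using hd 4 5 0 1 2 3 (by decide)
  obtain ⟨p, hp, hag⟩ := search (b 0 1 2) (b 0 1 3) (b 0 1 4) (b 0 1 5) (b 0 2 3) (b 0 2 4) (b 0 2 5) (b 0 3 4) (b 0 3 5)
      (b 0 4 5) (b 1 2 3) (b 1 2 4) (b 1 2 5) (b 1 3 4) (b 1 3 5) (b 1 4 5) (b 2 3 4)
      (b 2 3 5) (b 2 4 5) (b 3 4 5)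
    h01 h02 h03 h04 h05 h12 h13 h14 h15 h23 h24 h25 h34 h35 h45
    (by rw [hb]; exact decide_eq_true h012) (by rw [hb]; exact decide_eq_true h013)
  refine ⟨p, hp, p.1, (table_inj p hp).injOn, ?_⟩
  have hinj := table_inj p hp
  have hiff : ∀ s : Finset (Fin 6), s.card = 3 → (s ∈ K ↔ s.image p.1 ∈ p.2) := by
    intro s hs
    obtain ⟨x, hx, rfl⟩ := triples s hs
    have hx' : (x.1, x.2.1, x.2.2, b x.1 x.2.1 x.2.2) ∈
        ([(0, 1, 2, b 0 1 2), (0, 1, 3, b 0 1 3), (0, 1, 4, b 0 1 4), (0, 1, 5, b 0 1 5), (0, 2, 3, b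
      0 2 3), (0, 2, 4, b 0 2 4), (0, 2, 5, b 0 2 5), (0, 3, 4, b 0 3 4), (0, 3, 5, b 0 3
      5), (0, 4, 5, b 0 4 5), (1, 2, 3, b 1 2 3), (1, 2, 4, b 1 2 4), (1, 2, 5, b 1 2 5),
      (1, 3, 4, b 1 3 4), (1, 3, 5, b 1 3 5), (1, 4, 5, b 1 4 5), (2, 3, 4, b 2 3 4), (2, 3,
      5, b 2 3 5), (2, 4, 5, b 2 4 5), (3, 4, 5, b 3 4 5)] : List (Fin 6 × Fin 6 × Fin 6 × Bool)) :=
      List.mem_map_of_mem (f := fun x : Fin 6 × Fin 6 × Fin 6 =>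
        (x.1, x.2.1, x.2.2, b x.1 x.2.1 x.2.2)) hx
    have := List.all_eq_true.1 hag _ hx'
    simp only [beq_iff_eq, hb, decide_eq_decide] at this
    rw [this, Finset.image_insert, Finset.image_insert, Finset.image_singleton]
  ext u
  simp only [gen6, Finset.mem_filter, Finset.mem_univ, true_and, Finset.mem_image]
  constructor
  · rintro ⟨hu, t, ht, hut⟩
    have hsurj : Function.Surjective p.1 := Finite.surjective_of_injective hinj
    obtain ⟨t, rfl⟩ : ∃ t' : Finset (Fin 6), t'.image p.1 = t :=
      ⟨univ.filter fun i => p.1 i ∈ t, by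
        ext j
        obtain ⟨i, rfl⟩ := hsurj j
        simp [hinj.eq_iff]⟩
    obtain ⟨u, hu', rfl⟩ := Finset.subset_image_iff.1 hut
    have h3 : t.card = 3 := by
      rw [← Finset.card_image_of_injective t hinj]; exact table_card p hp _ ht
    exact ⟨u, hK.down t ((hiff t h3).2 ht) u hu' (Finset.image_nonempty.1 hu), rfl⟩
  · rintro ⟨s, hs, rfl⟩
    obtain ⟨t, ht, hst, h3⟩ := hK.tri s hs
    refine ⟨Finset.image_nonempty.2 ?_, t.image p.1, (hiff t h3).1 ht,
      Finset.image_subset_image hst⟩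
    rw [Finset.nonempty_iff_ne_empty]
    rintro rfl
    exact hK.hne hs

lemma shift_iso {M : Finset (Finset (Fin 6))} {L : Finset (Finset ℕ)}
    (h : L = (gen6 M).image (Finset.image fun i : Fin 6 => i.val + 1)) : Iso (gen6 M) L := by
  refine ⟨fun i => i.val + 1, ?_, h⟩
  intro i _ j _ hij
  exact Fin.ext (by simpa using hij)

lemma isoS : Iso (gen6 mS) S24 := shift_iso (by decide +kernel)
lemma isoJ : Iso (gen6 mJ) S13S02 := shift_iso (by decide +kernel)
lemma isoO : Iso (gen6 mO) Octa := shift_iso (by decide +kernel)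
lemma isoR : Iso (gen6 mR) RP26 := shift_iso (by decide +kernel)
lemma isoG : Iso (gen6 mG) Sigma1 := shift_iso (by decide +kernel)

/-- Any injective quadruple can be moved to `0, 1, 2, 3`. -/
lemma move (a b c d : Fin 6) (h : [a, b, c, d].Nodup) :
    ∃ σ : Equiv.Perm (Fin 6), σ a = 0 ∧ σ b = 1 ∧ σ c = 2 ∧ σ d = 3 := by
  have hi : Function.Injective ![a, b, c, d] := by
    revert a b c d; decide +kernel
  have hj : Function.Injective (![0, 1, 2, 3] : Fin 4 → Fin 6) := by decide
  obtain ⟨σ, hσ⟩ := (Equiv.Perm.isMultiplyPretransitive (Fin 6) 4).exists_smul_eq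
    ⟨![a, b, c, d], hi⟩ ⟨![0, 1, 2, 3], hj⟩
  have := fun i => DFunLike.congr_fun hσ i
  refine ⟨σ, ?_, ?_, ?_, ?_⟩
  · simpa using this 0
  · simpa using this 1
  · simpa using this 2
  · simpa using this 3

lemma exists_two {K : Finset (Finset (Fin 6))} (hK : Good K) (hne : K.Nonempty) :
    ∃ a b c d : Fin 6, [a, b, c, d].Nodup ∧ {a, b, c} ∈ K ∧ {a, b, d} ∈ K := by
  obtain ⟨s, hs⟩ := hne
  obtain ⟨t, ht, -, h3⟩ := hK.tri s hs
  obtain ⟨a, b, c, hab, hac, hbc, rfl⟩ := Finset.card_eq_three.1 h3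
  have hp : ({a, b} : Finset (Fin 6)) ∈ K :=
    hK.down _ ht _ (by intro y; simp; tauto) (by simp)
  have hd := hK.deg _ hp (Finset.card_pair hab)
  unfold degOf at hd
  obtain ⟨x, hx, hxt⟩ := Finset.exists_mem_ne (by rw [hd]; norm_num) ({a, b, c} : Finset (Fin 6))
  simp only [Finset.mem_filter] at hx
  obtain ⟨hxK, hsub, hc⟩ := hx
  have h1 : (x \ {a, b}).card = 1 := by
    rw [Finset.card_sdiff_of_subset hsub, Finset.card_pair hab, hc]
  obtain ⟨d, hv⟩ := Finset.card_eq_one.1 h1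
  have hx' : x = {a, b, d} := by
    rw [← Finset.union_sdiff_of_subset hsub, hv]
    ext y; simp
  have hvm : d ∈ x \ {a, b} := by rw [hv]; simp
  have hvn : ¬ (d = a ∨ d = b) := by simpa using (Finset.mem_sdiff.1 hvm).2
  have hcd : c ≠ d := by rintro rfl; exact hxt hx'
  refine ⟨a, b, c, d, ?_, ht, hx' ▸ hxK⟩
  simp only [List.nodup_cons, List.mem_cons, List.not_mem_nil, or_false, not_or]
  simp only [not_or] at hvn
  exact ⟨⟨hab, hac, Ne.symm hvn.1⟩, ⟨hbc, Ne.symm hvn.2⟩, hcd, not_false, List.nodup_nil⟩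

lemma main6 {K : Finset (Finset (Fin 6))} (hK : Good K) (hne : K.Nonempty) :
    Iso K S24 ∨ Iso K S13S02 ∨ Iso K Octa ∨ Iso K RP26 ∨ Iso K Sigma1 := by
  obtain ⟨a, b, c, d, hn, h1, h2⟩ := exists_two hK hne
  obtain ⟨σ, ha, hb, hc, hd⟩ := move a b c d hn
  have hK2 := good_image hK σ σ.injective.injOn
  have hi : Iso K (K.image (Finset.image σ)) := ⟨σ, σ.injective.injOn, rfl⟩
  obtain ⟨p, hp, hiso⟩ := core hK2
    (Finset.mem_image.2 ⟨_, h1, by simp [Finset.image_insert, ha, hb, hc]⟩)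
    (Finset.mem_image.2 ⟨_, h2, by simp [Finset.image_insert, ha, hb, hd]⟩)
  have hf := iso_trans hi hiso
  rcases table_mem p hp with h | h | h | h | h <;> rw [h] at hf
  · exact Or.inl (iso_trans hf isoS)
  · exact Or.inr (Or.inl (iso_trans hf isoJ))
  · exact Or.inr (Or.inr (Or.inl (iso_trans hf isoO)))
  · exact Or.inr (Or.inr (Or.inr (Or.inl (iso_trans hf isoR))))
  · exact Or.inr (Or.inr (Or.inr (Or.inr (iso_trans hf isoG))))

/-- Proposition 1: every 2-dimensional weak pseudomanifold on at
most 6 vertices is isomorphic to `S²₄`, `S¹₃ * S⁰₂`, `S⁰₂ * S⁰₂ * S⁰₂`,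
`ℝP²₆` or `Σ₁`. -/
theorem six_vertex_weak_pseudomanifolds {V : Type*} [DecidableEq V]
    (K : Finset (Finset V))
    (hw : IsWeakPseudomanifold 2 K) (h6 : (verts K).card ≤ 6) :
    Iso K S24 ∨ Iso K S13S02 ∨ Iso K Octa ∨ Iso K RP26 ∨ Iso K Sigma1 := by
  have hne : K.Nonempty := hw.1.1
  have hK := good_of_wpm hw
  obtain ⟨f, hf⟩ : ∃ f : V → Fin 6, Set.InjOn f ↑(verts K) := by
    have hc : Fintype.card (verts K) ≤ Fintype.card (Fin 6) := by simpa using h6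
    obtain ⟨e⟩ := Function.Embedding.nonempty_of_card_le hc
    refine ⟨fun v => if h : v ∈ verts K then e ⟨v, h⟩ else 0, ?_⟩
    intro x hx y hy hxy
    have hx' : x ∈ verts K := hx
    have hy' : y ∈ verts K := hy
    simp only [hx', hy', dif_pos] at hxy
    simpa using e.injective hxy
  have hi : Iso K (K.image (Finset.image f)) := ⟨f, hf, rfl⟩
  rcases main6 (good_image hK f hf) (hne.image _) with h | h | h | h | h
  · exact Or.inl (iso_trans hi h)
  · exact Or.inr (Or.inl (iso_trans hi h))
  · exact Or.inr (Or.inr (Or.inl (iso_trans hi h)))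
  · exact Or.inr (Or.inr (Or.inr (Or.inl (iso_trans hi h))))
  · exact Or.inr (Or.inr (Or.inr (Or.inr (iso_trans hi h))))

end HomologySpheres
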